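/- arXiv:1406.0763 — 4 statements merged into one kernel-verified Lean document; each statement's English description precedes it below -/
import Mathlib

section
/- Let G be a countable group, μ a probability measure on G whose support generates G as a semigroup, and π a unitary representation of G on a separable complex Hilbert space H. Let B₁(H) denote the closed unit ball of H equipped with the weak topology, with G acting by x ↦ π(g)x. If ν is a Borel probability measure on B₁(H) that is μ-stationary, i.e. Σ_{g} μ(g) ∫ φ(π(g)⁻¹ x) dν(x) = ∫ φ dν for every weakly continuous function φ on B₁(H), then ν is G-invariant: the pushforward of ν under x ↦ π(g)x equals ν for every g ∈ G. -/
open Filter MeasureTheory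
open scoped Classical InnerProductSpace

/-- A probability measure on a countable group, given as a weight function. -/
def IsProbMeasure {G : Type*} [Group G] (μ : G → ℝ) : Prop :=
  (∀ g, 0 ≤ μ g) ∧ HasSum μ 1

/-- The support of `μ` generates `G` as a semigroup. -/
def SuppGenerates {G : Type*} [Group G] (μ : G → ℝ) : Prop :=
  Subsemigroup.closure {g | 0 < μ g} = ⊤

noncomputable section

variable (H : Type*) [NormedAddCommGroup H] [InnerProductSpace ℂ H]

/-- The closed unit ball of `H`, considered with the weak topology. -/
def WeakUnitBall : Type _ := {x : H // ‖x‖ ≤ 1}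

instance : TopologicalSpace (WeakUnitBall H) :=
  TopologicalSpace.induced (fun x : WeakUnitBall H => toWeakSpace ℂ H x.1) inferInstance

instance : MeasurableSpace (WeakUnitBall H) := borel _

instance : BorelSpace (WeakUnitBall H) := ⟨rfl⟩

variable {H}

/-- The action of a unitary operator on the closed unit ball. -/
def ballMap (T : H ≃ₗᵢ[ℂ] H) : WeakUnitBall H → WeakUnitBall H :=
  fun x => ⟨T x.1, by rw [T.norm_map]; exact x.2⟩

end

section KernelMoments

open Topology

variable {X ι : Type*} {c : ι → X → ℝ} {K : X → X → ℝ}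

/-- Partial sums of a kernel with feature map in the unit ball of `ℓ²` are bounded by one. -/
lemma abs_sum_mul_le_one (hle : ∀ (s : Finset ι) x, ∑ i ∈ s, c i x ^ 2 ≤ 1)
    (s : Finset ι) (x y : X) : |∑ i ∈ s, c i x * c i y| ≤ 1 := by
  have h : (∑ i ∈ s, c i x * c i y) ^ 2 ≤ 1 :=
    (Finset.sum_mul_sq_le_sq_mul_sq s _ _).trans
      (mul_le_one₀ (hle s x) (Finset.sum_nonneg fun i _ => sq_nonneg _) (hle s y))
  exact (sq_le_one_iff_abs_le_one _).1 h

lemma abs_kernel_le_one (hle : ∀ (s : Finset ι) x, ∑ i ∈ s, c i x ^ 2 ≤ 1)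
    (hK : ∀ x y, HasSum (fun i => c i x * c i y) (K x y)) (x y : X) : |K x y| ≤ 1 :=
  le_of_tendsto (hK x y).abs (Eventually.of_forall fun s => abs_sum_mul_le_one hle s x y)

variable [TopologicalSpace X]

/-- A compact space with a countable point-separating family of continuous functions is Polish. -/
lemma polishSpace_of_countable_separating [Countable ι] [CompactSpace X]
    (hc : ∀ i, Continuous (c i)) (hsep : ∀ x y, (∀ i, c i x = c i y) → x = y) :
    PolishSpace X :=
  ((continuous_pi hc).isClosedEmbedding fun x y hxy => hsep x y (congrFun hxy)).polishSpace

variable [MeasurableSpace X] [BorelSpace X]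

/-- The integral of the `n`-th power of a kernel against a product measure is the sum of the
products of the moments of order `n`. -/
lemma tendsto_sum_moment_mul_moment [Countable ι] (hc : ∀ i, Continuous (c i))
    (hle : ∀ (s : Finset ι) x, ∑ i ∈ s, c i x ^ 2 ≤ 1)
    (hK : ∀ x y, HasSum (fun i => c i x * c i y) (K x y))
    (ρ σ : Measure X) [IsProbabilityMeasure ρ] [IsProbabilityMeasure σ] (n : ℕ) :
    Tendsto (fun s : Finset ι => ∑ a ∈ Fintype.piFinset (fun _ : Fin n => s),
        (∫ x, ∏ k, c (a k) x ∂ρ) * ∫ y, ∏ k, c (a k) y ∂σ) atTop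
      (𝓝 (∫ x, ∫ y, K x y ^ n ∂σ ∂ρ)) := by
  have hmeas : ∀ s : Finset ι, Measurable fun p : X × X => (∑ i ∈ s, c i p.1 * c i p.2) ^ n := by
    intro s
    have := fun i => (hc i).measurable
    fun_prop
  have hlim : ∀ p : X × X, Tendsto (fun s : Finset ι => (∑ i ∈ s, c i p.1 * c i p.2) ^ n) atTop
      (𝓝 (K p.1 p.2 ^ n)) := fun p => (hK p.1 p.2).pow n
  have hKmeas : Measurable fun p : X × X => K p.1 p.2 ^ n :=
    measurable_of_tendsto_metrizable' atTop hmeas (tendsto_pi_nhds.2 hlim)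
  have hKint : Integrable (fun p : X × X => K p.1 p.2 ^ n) (ρ.prod σ) :=
    Integrable.of_bound hKmeas.aestronglyMeasurable 1 (Eventually.of_forall fun p => by
      rw [norm_pow, Real.norm_eq_abs]
      exact pow_le_one₀ (abs_nonneg _) (abs_kernel_le_one hle hK _ _))
  rw [← integral_prod (fun p : X × X => K p.1 p.2 ^ n) hKint]
  have key : Tendsto (fun s : Finset ι => ∫ p : X × X, (∑ i ∈ s, c i p.1 * c i p.2) ^ n ∂(ρ.prod σ))
      atTop (𝓝 (∫ p : X × X, K p.1 p.2 ^ n ∂(ρ.prod σ))) :=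
    tendsto_integral_filter_of_dominated_convergence (fun _ => 1)
      (Eventually.of_forall fun s => (hmeas s).aestronglyMeasurable)
      (Eventually.of_forall fun s => Eventually.of_forall fun p => by
        rw [norm_pow, Real.norm_eq_abs]
        exact pow_le_one₀ (abs_nonneg _) (abs_sum_mul_le_one hle _ _ _))
      (integrable_const _) (Eventually.of_forall hlim)
  refine key.congr fun s => ?_
  have hcle : ∀ i x, |c i x| ≤ 1 := fun i x =>
    (sq_le_one_iff_abs_le_one _).1 (by simpa using hle {i} x)
  have hint : ∀ (τ : Measure X) [IsProbabilityMeasure τ] (a : Fin n → ι),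
      Integrable (fun x => ∏ k, c (a k) x) τ := fun τ _ a =>
    Integrable.of_bound
      (Continuous.measurable (by fun_prop)).aestronglyMeasurable 1
      (Eventually.of_forall fun x => by
        rw [norm_prod]
        exact Finset.prod_le_one (fun _ _ => norm_nonneg _) fun k _ => hcle (a k) x)
  simp_rw [Finset.sum_pow', Finset.prod_mul_distrib]
  rw [integral_finsetSum _ fun a _ => (hint ρ a).mul_prod (hint σ a)]
  exact Finset.sum_congr rfl fun a _ =>
    integral_prod_mul (L := ℝ) (fun x => ∏ k, c (a k) x) fun y => ∏ k, c (a k) y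

/-- The difference of two moments of order `n` is controlled by the energy distance associated with
the `n`-th power of the kernel. -/
lemma sq_moment_sub_moment_le [Countable ι] (hc : ∀ i, Continuous (c i))
    (hle : ∀ (s : Finset ι) x, ∑ i ∈ s, c i x ^ 2 ≤ 1)
    (hK : ∀ x y, HasSum (fun i => c i x * c i y) (K x y))
    (ρ σ : Measure X) [IsProbabilityMeasure ρ] [IsProbabilityMeasure σ] {n : ℕ} (a : Fin n → ι) :
    ((∫ x, ∏ k, c (a k) x ∂ρ) - ∫ x, ∏ k, c (a k) x ∂σ) ^ 2 ≤
      (∫ x, ∫ y, K x y ^ n ∂ρ ∂ρ) + (∫ x, ∫ y, K x y ^ n ∂σ ∂σ)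
        - 2 * ∫ x, ∫ y, K x y ^ n ∂σ ∂ρ := by
  have hlim := ((tendsto_sum_moment_mul_moment hc hle hK ρ ρ n).add
    (tendsto_sum_moment_mul_moment hc hle hK σ σ n)).sub
    ((tendsto_sum_moment_mul_moment hc hle hK ρ σ n).const_mul 2)
  refine ge_of_tendsto hlim ?_
  filter_upwards [eventually_ge_atTop (Finset.univ.image a)] with s hs
  rw [Finset.mul_sum, ← Finset.sum_add_distrib, ← Finset.sum_sub_distrib]
  have ha : a ∈ Fintype.piFinset (fun _ : Fin n => s) :=
    Fintype.mem_piFinset.2 fun k => hs (Finset.mem_image_of_mem a (Finset.mem_univ k))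
  refine le_trans (le_of_eq ?_) (Finset.single_le_sum (fun b _ => ?_) ha)
  · ring
  · nlinarith [sq_nonneg ((∫ x, ∏ k, c (b k) x ∂ρ) - ∫ x, ∏ k, c (b k) x ∂σ)]

/-- Finite measures on a compact space with the same moments with respect to a countable
point-separating family of continuous functions are equal. -/
lemma ext_of_forall_moment_eq [Countable ι] [CompactSpace X] (hc : ∀ i, Continuous (c i))
    (hsep : ∀ x y, (∀ i, c i x = c i y) → x = y)
    (ρ σ : Measure X) [IsFiniteMeasure ρ] [IsFiniteMeasure σ]
    (h : ∀ (n : ℕ) (a : Fin n → ι), ∫ x, ∏ k, c (a k) x ∂ρ = ∫ x, ∏ k, c (a k) x ∂σ) :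
    ρ = σ := by
  have : PolishSpace X := polishSpace_of_countable_separating hc hsep
  let C : ι → BoundedContinuousFunction X ℝ := fun i =>
    BoundedContinuousFunction.mkOfCompact ⟨c i, hc i⟩
  have hstar : ∀ f : BoundedContinuousFunction X ℝ, star f = f := fun f =>
    BoundedContinuousFunction.ext fun x => by simp
  let A : StarSubalgebra ℝ (BoundedContinuousFunction X ℝ) :=
    { Algebra.adjoin ℝ (Set.range C) with star_mem' := fun {f} hf => by rwa [hstar f] }
  refine ext_of_forall_mem_subalgebra_integral_eq_of_polish (𝕜 := ℝ) (A := A) ?_ ?_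
  · intro x y hxy
    by_contra! hne
    refine hxy (hsep x y fun i => ?_)
    exact hne _ ⟨_, ⟨C i, Algebra.subset_adjoin ⟨i, rfl⟩, rfl⟩, rfl⟩
  · intro f hf
    have hf' : f ∈ Submodule.span ℝ (Submonoid.closure (Set.range C) : Set _) := by
      rw [← Algebra.adjoin_eq_span]
      exact hf
    clear hf
    induction hf' using Submodule.span_induction with
    | mem f hf =>
      obtain ⟨l, hl, rfl⟩ := Submonoid.exists_list_of_mem_closure hf
      obtain ⟨L, rfl⟩ : l ∈ Set.range (List.map C) := by
        rw [Set.range_list_map]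
        exact hl
      have hL : ∀ x, (L.map C).prod x = ∏ k : Fin L.length, c L[k] x := fun x => by
        rw [← Fin.prod_univ_fun_getElem]
        simp [C]
      simpa only [hL] using h L.length fun k => L[k]
    | zero => simp
    | add f g _ _ hf hg =>
      simp only [BoundedContinuousFunction.coe_add, Pi.add_apply]
      rw [integral_add (f.integrable ρ) (g.integrable ρ),
        integral_add (f.integrable σ) (g.integrable σ), hf, hg]
    | smul r f _ hf =>
      simp only [BoundedContinuousFunction.coe_smul]
      rw [integral_smul, integral_smul, hf]

/-- A stationary probability measure for continuous maps preserving a kernel is invariant under the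
maps of positive weight. -/
lemma map_eq_of_stationary_of_kernel_invariant [Countable ι] [CompactSpace X]
    (hc : ∀ i, Continuous (c i)) (hsep : ∀ x y, (∀ i, c i x = c i y) → x = y)
    (hle : ∀ (s : Finset ι) x, ∑ i ∈ s, c i x ^ 2 ≤ 1)
    (hK : ∀ x y, HasSum (fun i => c i x * c i y) (K x y))
    (hKc : ∀ x, Continuous (K x)) {G : Type*} {μ : G → ℝ} (hμ : ∀ g, 0 ≤ μ g) (hsum : HasSum μ 1)
    {T : G → X → X} (hT : ∀ g, Continuous (T g)) (hKT : ∀ g x y, K (T g x) (T g y) = K x y)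
    (ν : Measure X) [IsProbabilityMeasure ν]
    (hstat : ∀ φ : X → ℝ, Continuous φ →
      HasSum (fun g => μ g * ∫ x, φ (T g x) ∂ν) (∫ x, φ x ∂ν))
    {g : G} (hg : 0 < μ g) : ν.map (T g) = ν := by
  have : PolishSpace X := polishSpace_of_countable_separating hc hsep
  have hprob : ∀ g, IsProbabilityMeasure (ν.map (T g)) := fun g =>
    Measure.isProbabilityMeasure_map (hT g).aemeasurable
  refine ext_of_forall_moment_eq hc hsep _ _ fun n a => ?_
  have hsymm : ∀ x y, K x y = K y x := fun x y =>
    (hK x y).unique (by simpa only [mul_comm] using hK y x)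
  have hcont : ∀ (τ : Measure X) [IsProbabilityMeasure τ],
      Continuous fun x => ∫ y, K x y ^ n ∂τ := by
    intro τ _
    refine continuous_of_dominated (bound := fun _ => 1)
      (fun x => ((hKc x).pow n).aestronglyMeasurable)
      (fun x => Eventually.of_forall fun y => ?_) (integrable_const _)
      (Eventually.of_forall fun y => ?_)
    · rw [norm_pow, Real.norm_eq_abs]
      exact pow_le_one₀ (abs_nonneg _) (abs_kernel_le_one hle hK _ _)
    · simp_rw [fun x => hsymm x y]
      exact (hKc y).pow n
  have hinv : ∀ g, ∫ x, ∫ y, K x y ^ n ∂(ν.map (T g)) ∂(ν.map (T g)) =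
      ∫ x, ∫ y, K x y ^ n ∂ν ∂ν := fun g => by
    have hinner : ∀ x, ∫ y, K x y ^ n ∂(ν.map (T g)) = ∫ y, K x (T g y) ^ n ∂ν := fun x =>
      integral_map (hT g).aemeasurable ((hKc x).pow n).aestronglyMeasurable
    rw [integral_map (hT g).aemeasurable (hcont _).aestronglyMeasurable]
    simp_rw [hinner, hKT]
  have hcross : ∀ g, ∫ x, ∫ y, K x y ^ n ∂ν ∂(ν.map (T g)) =
      ∫ x, ∫ y, K (T g x) y ^ n ∂ν ∂ν := fun g =>
    integral_map (hT g).aemeasurable (hcont ν).aestronglyMeasurable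
  have hdist : ∀ g, ((∫ x, ∏ k, c (a k) x ∂(ν.map (T g))) - ∫ x, ∏ k, c (a k) x ∂ν) ^ 2 ≤
      2 * ((∫ x, ∫ y, K x y ^ n ∂ν ∂ν) - ∫ x, ∫ y, K (T g x) y ^ n ∂ν ∂ν) := fun g => by
    have := sq_moment_sub_moment_le hc hle hK (ν.map (T g)) ν a
    rw [hinv, hcross] at this
    linarith
  have hzero : HasSum (fun g => μ g * ((∫ x, ∫ y, K x y ^ n ∂ν ∂ν) -
      ∫ x, ∫ y, K (T g x) y ^ n ∂ν ∂ν)) 0 := by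
    simpa [mul_sub] using (hsum.mul_right (∫ x, ∫ y, K x y ^ n ∂ν ∂ν)).sub (hstat _ (hcont ν))
  have hterm := congrFun ((hasSum_zero_iff_of_nonneg fun g => mul_nonneg (hμ g)
    (by linarith [hdist g, sq_nonneg ((∫ x, ∏ k, c (a k) x ∂(ν.map (T g))) -
      ∫ x, ∏ k, c (a k) x ∂ν)])).1 hzero) g
  have hdiff := (mul_eq_zero.1 hterm).resolve_left hg.ne'
  have := hdist g
  rw [hdiff, mul_zero] at this
  exact sub_eq_zero.1 (pow_eq_zero_iff two_ne_zero |>.1 (le_antisymm this (sq_nonneg _)))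

end KernelMoments

section WeakUnitBall

open Topology

variable {H : Type*} [NormedAddCommGroup H] [InnerProductSpace ℂ H]

/-- An orthonormal family in a separable inner product space is countable. -/
lemma Orthonormal.countable_of_separableSpace {𝕜 E ι : Type*} [RCLike 𝕜] [NormedAddCommGroup E]
    [InnerProductSpace 𝕜 E] [TopologicalSpace.SeparableSpace E] {v : ι → E}
    (hv : Orthonormal 𝕜 v) : Countable ι := by
  refine Set.countable_univ_iff.1 (Set.PairwiseDisjoint.countable_of_isOpen
    (s := fun i => Metric.ball (v i) (1 / 2)) ?_ (fun i _ => Metric.isOpen_ball)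
    fun i _ => Metric.nonempty_ball.2 (by norm_num))
  intro i _ j _ hij
  refine Metric.ball_disjoint_ball ?_
  have h : ‖v i - v j‖ ^ 2 = 2 := by
    rw [@norm_sub_sq 𝕜, hv.2 hij, hv.1, hv.1]
    norm_num
  rw [dist_eq_norm]
  nlinarith [norm_nonneg (v i - v j)]

lemma continuous_inner_weakUnitBall (v : H) :
    Continuous fun x : WeakUnitBall H => ⟪v, x.1⟫_ℂ :=
  (WeakBilin.eval_continuous (topDualPairing ℂ H).flip (innerSL ℂ v)).comp continuous_induced_dom

lemma continuous_weakUnitBall_iff [CompleteSpace H] {Y : Type*} [TopologicalSpace Y]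
    {f : Y → WeakUnitBall H} : Continuous f ↔ ∀ v, Continuous fun y => ⟪v, (f y).1⟫_ℂ := by
  refine ⟨fun hf v => (continuous_inner_weakUnitBall v).comp hf, fun h => ?_⟩
  refine continuous_induced_rng.2 (WeakBilin.continuous_of_continuous_eval _ fun l => ?_)
  obtain ⟨v, rfl⟩ := (InnerProductSpace.toDual ℂ H).surjective l
  exact h v

lemma continuous_ballMap [CompleteSpace H] (T : H ≃ₗᵢ[ℂ] H) : Continuous (ballMap T) := by
  refine continuous_weakUnitBall_iff.2 fun v => ?_
  have h : ∀ x : WeakUnitBall H, ⟪v, (ballMap T x).1⟫_ℂ = ⟪T.symm v, x.1⟫_ℂ := fun x => by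
    rw [← T.inner_map_map (T.symm v), T.apply_symm_apply]
    rfl
  simpa only [h] using continuous_inner_weakUnitBall (T.symm v)

/-- The closed unit ball of a Hilbert space is weakly compact. -/
instance [CompleteSpace H] : CompactSpace (WeakUnitBall H) := by
  let D := WeakDual.toStrongDual ⁻¹' Metric.closedBall (0 : StrongDual ℂ H) 1
  have : CompactSpace D := isCompact_iff_compactSpace.1 (WeakDual.isCompact_closedBall 0 1)
  let F : D → WeakUnitBall H := fun f =>
    ⟨(InnerProductSpace.toDual ℂ H).symm (WeakDual.toStrongDual f.1), by
      rw [LinearIsometryEquiv.norm_map]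
      exact mem_closedBall_zero_iff.1 f.2⟩
  have hF : Continuous F := by
    refine continuous_weakUnitBall_iff.2 fun v => ?_
    have h : ∀ f : D, ⟪v, (F f).1⟫_ℂ = star (f.1 v) := fun f => by
      rw [← inner_conj_symm, InnerProductSpace.toDual_symm_apply]
      rfl
    simp_rw [h]
    exact ((WeakDual.eval_continuous v).comp continuous_subtype_val).star
  refine Function.Surjective.compactSpace hF fun x => ?_
  refine ⟨⟨StrongDual.toWeakDual (InnerProductSpace.toDual ℂ H x.1), ?_⟩, ?_⟩
  · exact mem_closedBall_zero_iff.2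
      (((InnerProductSpace.toDual ℂ H).norm_map x.1).trans_le x.2)
  · exact Subtype.ext (LinearIsometryEquiv.symm_apply_apply _ _)

/-- In a separable Hilbert space, a stationary measure on the weak unit ball is invariant under the
isometries of positive weight. -/
lemma map_ballMap_eq_of_stationary [CompleteSpace H] [TopologicalSpace.SeparableSpace H]
    {G : Type*} {μ : G → ℝ} (hμ : ∀ g, 0 ≤ μ g) (hsum : HasSum μ 1) {T : G → H ≃ₗᵢ[ℂ] H}
    (ν : Measure (WeakUnitBall H)) [IsProbabilityMeasure ν]
    (hstat : ∀ φ : WeakUnitBall H → ℝ, Continuous φ →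
      HasSum (fun g => μ g * ∫ x, φ (ballMap (T g) x) ∂ν) (∫ x, φ x ∂ν))
    {g : G} (hg : 0 < μ g) : ν.map (ballMap (T g)) = ν := by
  let : InnerProductSpace ℝ H := InnerProductSpace.rclikeToReal ℂ H
  obtain ⟨w, b, -⟩ := exists_hilbertBasis ℝ H
  have : Countable w := b.orthonormal.countable_of_separableSpace
  have hcont : ∀ v : H, Continuous fun x : WeakUnitBall H => ⟪v, x.1⟫_ℝ := fun v =>
    Complex.continuous_re.comp (continuous_inner_weakUnitBall v)
  refine map_eq_of_stationary_of_kernel_invariant (c := fun i x => ⟪b i, x.1⟫_ℝ)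
    (K := fun x y => ⟪x.1, y.1⟫_ℝ) (T := fun g => ballMap (T g)) (fun i => hcont _)
    (fun x y hxy => ?_) (fun s x => ?_) (fun x y => ?_) (fun x => hcont _) hμ hsum
    (fun g => continuous_ballMap _) (fun g x y => ?_) ν hstat hg
  · refine Subtype.ext (b.repr.injective (lp.ext (funext fun i => ?_)))
    simpa only [b.repr_apply_apply] using hxy i
  · have h := b.orthonormal.sum_inner_products_le x.1 (s := s)
    simp only [Real.norm_eq_abs, sq_abs] at h
    exact h.trans (pow_le_one₀ (norm_nonneg _) x.2)
  · simpa only [real_inner_comm] using b.hasSum_inner_mul_inner x.1 y.1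
  · exact congrArg Complex.re ((T g).inner_map_map x.1 y.1)

end WeakUnitBall


/-- a `μ`-stationary Borel probability measure on the weakly-topologized
closed unit ball of a separable complex Hilbert space, for the action induced by a unitary
representation `π` of `G`, is `G`-invariant. -/
theorem stationary_on_hilbert_ball_invariant {G : Type*} [Group G] [Countable G]
    (μ : G → ℝ) (hprob : IsProbMeasure μ) (hgen : SuppGenerates μ)
    (H : Type*) [NormedAddCommGroup H] [InnerProductSpace ℂ H] [CompleteSpace H]
    [TopologicalSpace.SeparableSpace H]
    (π : G →* (H ≃ₗᵢ[ℂ] H))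
    (ν : Measure (WeakUnitBall H)) [IsProbabilityMeasure ν]
    (hstat : ∀ φ : WeakUnitBall H → ℝ, Continuous φ →
        HasSum (fun g : G => μ g * ∫ x, φ (ballMap (π g⁻¹) x) ∂ν) (∫ x, φ x ∂ν)) :
    ∀ g : G, Measure.map (ballMap (π g)) ν = ν := by
  have hsupp : ∀ g, 0 < μ g → Measure.map (ballMap (π g⁻¹)) ν = ν := fun g hg =>
    map_ballMap_eq_of_stationary (T := fun g => π g⁻¹) hprob.1 hprob.2 ν hstat hg
  have hmap : ∀ g h : G, (Measure.map (ballMap (π h)) ν).map (ballMap (π g)) =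
      Measure.map (ballMap (π (g * h))) ν := fun g h => by
    rw [Measure.map_map (continuous_ballMap _).measurable (continuous_ballMap _).measurable,
      map_mul]
    rfl
  have hone : Measure.map (ballMap (π 1)) ν = ν := by
    rw [map_one]
    exact Measure.map_id
  intro g
  have hg : g ∈ Subsemigroup.closure {g | 0 < μ g} := hgen ▸ Subsemigroup.mem_top g
  induction hg using Subsemigroup.closure_induction with
  | mem g hg =>
    conv_lhs => rw [← hsupp g hg]
    rw [hmap, mul_inv_cancel, hone]
  | mul g h _ _ ihg ihh => rw [← hmap, ihh, ihg]
end

section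
/- Let F₂ be the free group on two free generators a and b, and for n ≥ 1 let S_n ⊂ F₂ be the sphere of radius n, i.e. the set of elements whose reduced word in a, b, a⁻¹, b⁻¹ has length exactly n. Suppose A ⊆ F₂ is large in the sense that limsup_{m→∞} (1/m) Σ_{n=1}^{m} |A ∩ S_n| / |S_n| > 0. Then there exists a finite set F ⊂ F₂ such that the product set F A A⁻¹ = { f x y⁻¹ : f ∈ F, x, y ∈ A } is right thick: it contains a right translate of every finite subset of F₂. -/
open Filter

/-- The sphere of radius `n` in the free group on two generators: elements whose reduced
word has length exactly `n`. -/
def freeSphere (n : ℕ) : Set (FreeGroup Bool) :=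
  {g : FreeGroup Bool | (FreeGroup.toWord g).length = n}

/-- `A` is large: `limsup_m (1/m) ∑_{n=1}^m |A ∩ S_n|/|S_n| > 0`. -/
noncomputable def IsLargeInF2 (A : Set (FreeGroup Bool)) : Prop :=
  0 < limsup (fun m : ℕ =>
      (∑ n ∈ Finset.Icc 1 m,
        ((A ∩ freeSphere n).ncard : ℝ) / ((freeSphere n).ncard : ℝ)) / (m : ℝ)) atTop

/-- `T` is right thick: it contains a right translate of every finite subset. -/
def IsRightThick {G : Type*} [Group G] (T : Set G) : Prop :=
  ∀ E : Finset G, ∃ g : G, ∀ e ∈ E, e * g ∈ T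

open Topology
open scoped Pointwise

/-- A finitely additive, `[0, 1]`-valued set function on the free group that is stationary
for left translation by a uniformly random letter. -/
structure StationaryContent (M : Set (FreeGroup Bool) → ℝ) : Prop where
  nonneg : ∀ B, 0 ≤ M B
  le_one : ∀ B, M B ≤ 1
  union : ∀ B C, Disjoint B C → M (B ∪ C) = M B + M C
  stationary : ∀ B, ∑ x : Bool × Bool, M (FreeGroup.mk [x] • B) = 4 * M B

namespace StationaryContent

variable {M : Set (FreeGroup Bool) → ℝ}

/-- The content of the translates of `A` is harmonic, so it stays close to its supremum at
bounded distance from any point where it is close to its supremum. -/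
theorem exists_seq_tendsto_iSup (hM : StationaryContent M) (A : Set (FreeGroup Bool)) :
    ∃ u : ℕ → FreeGroup Bool, ∀ e : FreeGroup Bool,
      Tendsto (fun n => M ((e * u n) • A)) atTop (𝓝 (⨆ g : FreeGroup Bool, M (g • A))) := by
  have hbdd : BddAbove (Set.range fun g : FreeGroup Bool => M (g • A)) :=
    ⟨1, by rintro _ ⟨g, rfl⟩; exact hM.le_one _⟩
  obtain ⟨v, -, hv, hvmem⟩ := exists_seq_tendsto_sSup (Set.range_nonempty _) hbdd
  choose u hu using hvmem
  refine ⟨u, fun e => ?_⟩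
  rw [← FreeGroup.mk_toWord (x := e)]
  induction e.toWord with
  | nil =>
    have hone : FreeGroup.mk ([] : List (Bool × Bool)) = 1 := rfl
    simpa only [hone, one_mul, hu, iSup] using hv
  | cons x L ih =>
    set H := ⨆ g : FreeGroup Bool, M (g • A)
    have hle : ∀ g : FreeGroup Bool, M (g • A) ≤ H := fun g => le_ciSup hbdd g
    have hcons : FreeGroup.mk (x :: L) = FreeGroup.mk [x] * FreeGroup.mk L := by
      rw [FreeGroup.mul_mk, List.singleton_append]
    have hlow : Tendsto (fun n => 4 * M ((FreeGroup.mk L * u n) • A) - 3 * H) atTop (𝓝 H) := by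
      have h := (ih.const_mul 4).sub_const (3 * H)
      convert h using 2
      ring
    refine tendsto_of_tendsto_of_tendsto_of_le_of_le hlow tendsto_const_nhds
      (fun n => ?_) (fun n => hle _)
    have hs := hM.stationary ((FreeGroup.mk L * u n) • A)
    rw [← Finset.add_sum_erase _ _ (Finset.mem_univ x)] at hs
    have hrest : ∑ y ∈ Finset.univ.erase x,
        M (FreeGroup.mk [y] • (FreeGroup.mk L * u n) • A) ≤ 3 * H := by
      refine (Finset.sum_le_card_nsmul _ _ H fun y _ => ?_).trans (le_of_eq ?_)
      · rw [smul_smul]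
        exact hle _
      · rw [Finset.card_erase_of_mem (Finset.mem_univ x)]
        simp
    rw [smul_smul] at hs
    simp only [hcons, mul_assoc] at hs ⊢
    linarith

theorem exists_rightThick_product (hM : StationaryContent M) {A : Set (FreeGroup Bool)}
    (hA : 0 < M A) :
    ∃ F : Finset (FreeGroup Bool),
      IsRightThick {t : FreeGroup Bool | ∃ f ∈ F, ∃ x ∈ A, ∃ y ∈ A, t = f * x * y⁻¹} := by
  classical
  obtain ⟨u, hu⟩ := hM.exists_seq_tendsto_iSup A
  set H := ⨆ g : FreeGroup Bool, M (g • A)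
  have hHpos : 0 < H := by
    refine hA.trans_le ?_
    have hbdd : BddAbove (Set.range fun g : FreeGroup Bool => M (g • A)) :=
      ⟨1, by rintro _ ⟨g, rfl⟩; exact hM.le_one _⟩
    simpa using le_ciSup hbdd 1
  have hbddF : BddAbove (Set.range fun F : Finset (FreeGroup Bool) => M (⋃ f ∈ F, f • A)) :=
    ⟨1, by rintro _ ⟨g, rfl⟩; exact hM.le_one _⟩
  obtain ⟨F, hF⟩ := exists_lt_of_lt_ciSup
    (show (⨆ F : Finset (FreeGroup Bool), M (⋃ f ∈ F, f • A)) - H / 2 <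
      ⨆ F : Finset (FreeGroup Bool), M (⋃ f ∈ F, f • A) by linarith)
  refine ⟨F, fun E => ?_⟩
  have hev : ∀ᶠ n in atTop, ∀ e ∈ E, H / 2 < M ((e * u n) • A) :=
    (Finset.eventually_all E).2 fun e _ => (hu e).eventually_const_lt (half_lt_self hHpos)
  obtain ⟨n, hn⟩ := hev.exists
  refine ⟨u n, fun e he => ?_⟩
  have hmeet : ¬ Disjoint ((e * u n) • A) (⋃ f ∈ F, f • A) := by
    intro hdisj
    have hsup := le_ciSup hbddF (insert (e * u n) F)
    simp only [Finset.set_biUnion_insert] at hsup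
    rw [hM.union _ _ hdisj] at hsup
    linarith [hn e he]
  obtain ⟨z, ⟨y, hy, rfl⟩, hz⟩ := Set.not_disjoint_iff.1 hmeet
  simp only [Set.mem_iUnion] at hz
  obtain ⟨f, hf, x, hx, hxy⟩ := hz
  refine ⟨f, hf, x, hx, y, hy, ?_⟩
  simp only [smul_eq_mul] at hxy
  rw [hxy, mul_inv_cancel_right]

end StationaryContent

theorem freeSphere_finite (n : ℕ) : (freeSphere n).Finite :=
  (List.finite_length_eq (Bool × Bool) n).preimage FreeGroup.toWord_injective.injOn

/-- Multiplying a nontrivial reduced word by a letter on the left shortens it for exactly one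
letter and lengthens it for the three others; from the empty word all four letters lengthen. -/
theorem card_letters_smul_mem_freeSphere (b : FreeGroup Bool) (n : ℕ) :
    (∑ x : Bool × Bool, if (FreeGroup.mk [x] * b).toWord.length = n then 1 else 0) =
      (if b.toWord.length = n + 1 then 1 else 0) + 3 * (if b.toWord.length + 1 = n then 1 else 0) +
        if b.toWord.length = 0 ∧ n = 1 then 1 else 0 := by
  have hword : ∀ x : Bool × Bool,
      (FreeGroup.mk [x] * b).toWord = FreeGroup.reduce (x :: b.toWord) := fun x => by
    conv_lhs => rw [← FreeGroup.mk_toWord (x := b), FreeGroup.mul_mk, FreeGroup.toWord_mk]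
    rfl
  have hred : FreeGroup.reduce b.toWord = b.toWord := FreeGroup.reduce_toWord b
  simp only [hword, FreeGroup.reduce.cons, hred]
  rcases b.toWord with _ | ⟨⟨i, j⟩, L⟩
  · simp only [Fintype.sum_prod_type, Fintype.sum_bool, List.length_nil, List.length_singleton]
    grind
  · cases i <;> cases j <;>
      simp only [Fintype.sum_prod_type, Fintype.sum_bool, Bool.not_true, Bool.not_false,
        reduceCtorEq, and_true, and_false, if_true, if_false, List.length_cons] <;>
      grind

/-- The number of elements of `B` of length `n`. -/
noncomputable def sphereCount (B : Set (FreeGroup Bool)) (n : ℕ) : ℕ :=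
  (B ∩ freeSphere n).ncard

open Classical in
theorem sphereCount_smul_eq_sum (B : Set (FreeGroup Bool)) (g : FreeGroup Bool) (n : ℕ)
    (T : Finset (FreeGroup Bool)) (hT : ∀ b, (g * b).toWord.length = n → b ∈ T) :
    sphereCount (g • B) n =
      ∑ b ∈ T with b ∈ B, if (g * b).toWord.length = n then 1 else 0 := by
  rw [← Finset.card_filter, Finset.filter_filter, sphereCount, ← Set.ncard_coe_finset]
  refine Eq.trans ?_ (Set.ncard_image_of_injective _ (mul_right_injective g))
  congr 1
  ext z
  simp only [Set.mem_inter_iff, freeSphere, Set.mem_ofPred_eq, Set.mem_image, Finset.coe_filter,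
    Set.mem_smul_set, smul_eq_mul]
  constructor
  · rintro ⟨⟨b, hb, rfl⟩, hz⟩
    exact ⟨b, ⟨hT b hz, hb, hz⟩, rfl⟩
  · rintro ⟨b, ⟨-, hb, hz⟩, rfl⟩
    exact ⟨⟨b, hb, rfl⟩, hz⟩

open Classical in
theorem sum_sphereCount_smul (B : Set (FreeGroup Bool)) (n : ℕ) :
    ∑ x : Bool × Bool, sphereCount (FreeGroup.mk [x] • B) (n + 1) =
      sphereCount B (n + 2) + 3 * sphereCount B n + if n = 0 then sphereCount B 0 else 0 := by
  have hfin : (⋃ x : Bool × Bool, (fun b => FreeGroup.mk [x] * b) ⁻¹' freeSphere (n + 1)).Finite :=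
    Set.finite_iUnion fun x =>
      (freeSphere_finite (n + 1)).preimage (mul_right_injective (FreeGroup.mk [x])).injOn
  set T := hfin.toFinset ∪ (freeSphere_finite (n + 2)).toFinset ∪ (freeSphere_finite n).toFinset
    with hT
  have hx : ∀ x : Bool × Bool, sphereCount (FreeGroup.mk [x] • B) (n + 1) =
      ∑ b ∈ T with b ∈ B, if (FreeGroup.mk [x] * b).toWord.length = n + 1 then 1 else 0 := by
    refine fun x => sphereCount_smul_eq_sum B _ _ T fun b hb => ?_
    simp only [hT, Finset.mem_union, Set.Finite.mem_toFinset, Set.mem_iUnion]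
    exact Or.inl (Or.inl ⟨x, hb⟩)
  have hup : sphereCount B (n + 2) =
      ∑ b ∈ T with b ∈ B, if b.toWord.length = n + 2 then 1 else 0 := by
    have h := sphereCount_smul_eq_sum B 1 (n + 2) T fun b hb => by
      rw [one_mul] at hb
      simp [hT, freeSphere, hb]
    simpa only [one_smul, one_mul] using h
  have hdown : sphereCount B n =
      ∑ b ∈ T with b ∈ B, if b.toWord.length = n then 1 else 0 := by
    have h := sphereCount_smul_eq_sum B 1 n T fun b hb => by
      rw [one_mul] at hb
      simp [hT, freeSphere, hb]
    simpa only [one_smul, one_mul] using h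
  have hzero : (if n = 0 then sphereCount B 0 else 0) =
      ∑ b ∈ T with b ∈ B, if b.toWord.length = 0 ∧ n + 1 = 1 then 1 else 0 := by
    split_ifs with hn
    · subst hn
      simpa using hdown
    · simp [hn]
  rw [hzero, hup, hdown, Finset.sum_congr rfl fun x _ => hx x, Finset.sum_comm, Finset.mul_sum,
    ← Finset.sum_add_distrib, ← Finset.sum_add_distrib]
  refine Finset.sum_congr rfl fun b _ => ?_
  rw [card_letters_smul_mem_freeSphere]
  simp only [Nat.add_right_cancel_iff]

theorem sphereCount_univ (n : ℕ) : sphereCount Set.univ n = (freeSphere n).ncard := by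
  rw [sphereCount, Set.univ_inter]

theorem freeSphere_zero_ncard : (freeSphere 0).ncard = 1 := by
  rw [Set.ncard_eq_one]
  refine ⟨1, ?_⟩
  ext g
  simp [freeSphere]

theorem freeSphere_one_ncard : (freeSphere 1).ncard = 4 := by
  have himage : freeSphere 1 = (fun x : Bool × Bool => FreeGroup.mk [x]) '' Set.univ := by
    ext g
    simp only [freeSphere, Set.mem_ofPred_eq, List.length_eq_one_iff, Set.image_univ,
      Set.mem_range]
    constructor
    · rintro ⟨x, hx⟩
      exact ⟨x, by rw [← hx, FreeGroup.mk_toWord]⟩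
    · rintro ⟨x, rfl⟩
      exact ⟨x, by simp [FreeGroup.toWord_mk]⟩
  have hinj : Function.Injective fun x : Bool × Bool => FreeGroup.mk [x] := by
    intro x y hxy
    simpa [FreeGroup.toWord_mk] using congrArg FreeGroup.toWord hxy
  rw [himage, Set.ncard_image_of_injective _ hinj, Set.ncard_univ]
  simp

theorem freeSphere_succ_ncard (n : ℕ) : (freeSphere (n + 1)).ncard = 4 * 3 ^ n := by
  have hrec : ∀ n, 4 * (freeSphere (n + 1)).ncard = (freeSphere (n + 2)).ncard +
      3 * (freeSphere n).ncard + if n = 0 then 1 else 0 := fun n => by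
    have h := sum_sphereCount_smul Set.univ n
    simpa [sphereCount_univ, freeSphere_zero_ncard] using h
  induction n using Nat.strong_induction_on with
  | _ n ih =>
    match n with
    | 0 => simpa using freeSphere_one_ncard
    | 1 =>
      have h := hrec 0
      rw [freeSphere_one_ncard, freeSphere_zero_ncard] at h
      simp only [if_true, zero_add] at h
      norm_num
      omega
    | k + 2 =>
      have h := hrec (k + 1)
      rw [ih k (by omega), ih (k + 1) (by omega)] at h
      simp only [Nat.add_eq_zero_iff, one_ne_zero, and_false, if_false] at h
      rw [pow_succ] at h
      rw [pow_succ, pow_succ]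
      change 4 * (4 * (3 ^ k * 3)) = (freeSphere (k + 2 + 1)).ncard + _ + 0 at h
      omega

/-- The proportion of the sphere of radius `n` that lies in `B`. -/
noncomputable def sphereDensity (B : Set (FreeGroup Bool)) (n : ℕ) : ℝ :=
  ((B ∩ freeSphere n).ncard : ℝ) / ((freeSphere n).ncard : ℝ)

/-- The average of the sphere densities of `B` over the radii `1, …, m`. -/
noncomputable def cesaroDensity (B : Set (FreeGroup Bool)) (m : ℕ) : ℝ :=
  (∑ n ∈ Finset.Icc 1 m, sphereDensity B n) / (m : ℝ)

theorem sphereDensity_nonneg (B : Set (FreeGroup Bool)) (n : ℕ) : 0 ≤ sphereDensity B n := by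
  unfold sphereDensity
  positivity

theorem sphereDensity_le_one (B : Set (FreeGroup Bool)) (n : ℕ) : sphereDensity B n ≤ 1 := by
  refine div_le_one_of_le₀ ?_ (Nat.cast_nonneg _)
  exact_mod_cast Set.ncard_le_ncard Set.inter_subset_right (freeSphere_finite n)

theorem sphereDensity_union {B C : Set (FreeGroup Bool)} (h : Disjoint B C) (n : ℕ) :
    sphereDensity (B ∪ C) n = sphereDensity B n + sphereDensity C n := by
  unfold sphereDensity
  rw [Set.union_inter_distrib_right, Set.ncard_union_eq
    (h.mono Set.inter_subset_left Set.inter_subset_left)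
    ((freeSphere_finite n).subset Set.inter_subset_right)
    ((freeSphere_finite n).subset Set.inter_subset_right), Nat.cast_add, add_div]

theorem sum_sphereDensity_smul (B : Set (FreeGroup Bool)) (n : ℕ) :
    ∑ x : Bool × Bool, sphereDensity (FreeGroup.mk [x] • B) (n + 2) =
      3 * sphereDensity B (n + 3) + sphereDensity B (n + 1) := by
  have h := sum_sphereCount_smul B (n + 1)
  simp only [Nat.add_eq_zero_iff, one_ne_zero, and_false, if_false, add_zero] at h
  have h' := congrArg (Nat.cast : ℕ → ℝ) h
  push_cast at h'
  unfold sphereDensity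
  rw [← Finset.sum_div]
  simp only [sphereCount] at h'
  change ∑ x : Bool × Bool, (((FreeGroup.mk [x] • B) ∩ freeSphere (n + 2)).ncard : ℝ) =
    ((B ∩ freeSphere (n + 3)).ncard : ℝ) + _ at h'
  rw [h', freeSphere_succ_ncard, freeSphere_succ_ncard, freeSphere_succ_ncard]
  push_cast
  field_simp
  ring

theorem cesaroDensity_nonneg (B : Set (FreeGroup Bool)) (m : ℕ) : 0 ≤ cesaroDensity B m :=
  div_nonneg (Finset.sum_nonneg fun n _ => sphereDensity_nonneg B n) (Nat.cast_nonneg m)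

theorem cesaroDensity_le_one (B : Set (FreeGroup Bool)) (m : ℕ) : cesaroDensity B m ≤ 1 := by
  refine div_le_one_of_le₀ ?_ (Nat.cast_nonneg m)
  refine (Finset.sum_le_card_nsmul _ _ 1 fun n _ => sphereDensity_le_one B n).trans ?_
  simp

theorem cesaroDensity_union {B C : Set (FreeGroup Bool)} (h : Disjoint B C) (m : ℕ) :
    cesaroDensity (B ∪ C) m = cesaroDensity B m + cesaroDensity C m := by
  unfold cesaroDensity
  rw [← add_div, ← Finset.sum_add_distrib]
  simp only [sphereDensity_union h]

/-- The defect of stationarity telescopes, so it is bounded before averaging. -/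
theorem sum_Icc_sphereDensity_smul_sub (B : Set (FreeGroup Bool)) (m : ℕ) :
    ∑ n ∈ Finset.Icc 1 (m + 1),
        (∑ x : Bool × Bool, sphereDensity (FreeGroup.mk [x] • B) n - 4 * sphereDensity B n) =
      ∑ x : Bool × Bool, sphereDensity (FreeGroup.mk [x] • B) 1 - 3 * sphereDensity B 1 -
        3 * sphereDensity B 2 + 3 * sphereDensity B (m + 2) - sphereDensity B (m + 1) := by
  induction m with
  | zero =>
    simp only [zero_add, Finset.Icc_self, Finset.sum_singleton]
    ring
  | succ m ih =>
    rw [Finset.sum_Icc_succ_top (by omega), ih, sum_sphereDensity_smul]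
    ring

theorem tendsto_cesaroDensity_smul_sub (B : Set (FreeGroup Bool)) :
    Tendsto (fun m => ∑ x : Bool × Bool, cesaroDensity (FreeGroup.mk [x] • B) m -
      4 * cesaroDensity B m) atTop (𝓝 0) := by
  rw [← tendsto_add_atTop_iff_nat 1]
  have heq : ∀ m : ℕ, ∑ x : Bool × Bool, cesaroDensity (FreeGroup.mk [x] • B) m -
      4 * cesaroDensity B m = (∑ n ∈ Finset.Icc 1 m,
        (∑ x : Bool × Bool, sphereDensity (FreeGroup.mk [x] • B) n - 4 * sphereDensity B n)) *
          (m : ℝ)⁻¹ := fun m => by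
    unfold cesaroDensity
    rw [Finset.sum_sub_distrib, Finset.sum_comm, ← Finset.sum_div, ← Finset.mul_sum]
    ring
  simp only [heq, sum_Icc_sphereDensity_smul_sub]
  refine bdd_le_mul_tendsto_zero (b := -7) (B := 7) (.of_forall fun m => ?_)
    (.of_forall fun m => ?_) (tendsto_inv_atTop_nhds_zero_nat.comp (tendsto_add_atTop_nat 1))
  all_goals
    have hnonneg : 0 ≤ ∑ x : Bool × Bool, sphereDensity (FreeGroup.mk [x] • B) 1 :=
      Finset.sum_nonneg fun x _ => sphereDensity_nonneg _ _
    have hle : ∑ x : Bool × Bool, sphereDensity (FreeGroup.mk [x] • B) 1 ≤ 4 := by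
      refine (Finset.sum_le_card_nsmul _ _ 1 fun x _ => sphereDensity_le_one _ _).trans ?_
      simp
    linarith [sphereDensity_nonneg B 1, sphereDensity_nonneg B 2, sphereDensity_nonneg B (m + 1),
      sphereDensity_nonneg B (m + 2), sphereDensity_le_one B 1, sphereDensity_le_one B 2,
      sphereDensity_le_one B (m + 1), sphereDensity_le_one B (m + 2)]

theorem IsLargeInF2.exists_stationaryContent {A : Set (FreeGroup Bool)} (hA : IsLargeInF2 A) :
    ∃ M : Set (FreeGroup Bool) → ℝ, StationaryContent M ∧ 0 < M A := by
  change 0 < limsup (cesaroDensity A) atTop at hA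
  obtain ⟨c, hc, hcA⟩ := exists_between hA
  have hfreq : ∃ᶠ m in atTop, c < cesaroDensity A m :=
    frequently_lt_of_lt_limsup
      (isBoundedUnder_of ⟨0, cesaroDensity_nonneg A⟩ : IsBoundedUnder (· ≥ ·) atTop
        (cesaroDensity A)).isCoboundedUnder_le hcA
  have : NeBot (atTop ⊓ 𝓟 {m | c < cesaroDensity A m}) := frequently_mem_iff_neBot.1 hfreq
  set U := Ultrafilter.of (atTop ⊓ 𝓟 {m | c < cesaroDensity A m})
  have hUle : (U : Filter ℕ) ≤ atTop ⊓ 𝓟 {m | c < cesaroDensity A m} := Ultrafilter.of_le _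
  have hlim : ∀ B, ∃ l, Tendsto (cesaroDensity B) U (𝓝 l) := fun B => by
    obtain ⟨l, -, hl⟩ := isCompact_Icc.ultrafilter_le_nhds (U.map (cesaroDensity B))
      (le_principal_iff.2 (mem_map.2 (univ_mem' fun m =>
        Set.mem_Icc.2 ⟨cesaroDensity_nonneg B m, cesaroDensity_le_one B m⟩)))
    exact ⟨l, hl⟩
  choose M hM using hlim
  refine ⟨M, ⟨fun B => ge_of_tendsto' (hM B) (cesaroDensity_nonneg B),
    fun B => le_of_tendsto' (hM B) (cesaroDensity_le_one B), fun B C h => ?_, fun B => ?_⟩, ?_⟩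
  · refine tendsto_nhds_unique (hM (B ∪ C)) ?_
    simpa only [← cesaroDensity_union h] using (hM B).add (hM C)
  · have hdiff := (tendsto_finsetSum Finset.univ fun (x : Bool × Bool) _ =>
      hM (FreeGroup.mk [x] • B)).sub ((hM B).const_mul 4)
    exact sub_eq_zero.1 (tendsto_nhds_unique hdiff
      ((tendsto_cesaroDensity_smul_sub B).mono_left (hUle.trans inf_le_left)))
  · refine hc.trans_le (ge_of_tendsto (hM A) ?_)
    filter_upwards [hUle (mem_inf_of_right (mem_principal_self _))] with m hm
    exact hm.le

/-- Björklund–Fish, weak version: if `A ⊆ F₂` is large, then there is a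
finite set `F` such that `F A A⁻¹` is right thick. -/
theorem large_set_product_right_thick (A : Set (FreeGroup Bool)) (hA : IsLargeInF2 A) :
    ∃ F : Finset (FreeGroup Bool),
      IsRightThick {t : FreeGroup Bool | ∃ f ∈ F, ∃ x ∈ A, ∃ y ∈ A, t = f * x * y⁻¹} := by
  obtain ⟨M, hM, hMA⟩ := hA.exists_stationaryContent
  exact hM.exists_rightThick_product hMA
end

section
/- Let (G, μ) be a measured group and suppose A ⊆ G has positive measure with respect to some left μ-harmonic mean on G, i.e. there is a left μ-harmonic mean λ on G with λ(χ_A) > 0. Then there exists a finite set F ⊆ G and a left μ-harmonic mean η on G such that η(χ_{F A A⁻¹}) = 1, where F A A⁻¹ = { f x y⁻¹ : f ∈ F, x, y ∈ A }. -/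
open Filter
open scoped Classical

/-- A bounded function on `G`, i.e. an element of `ℓ∞(G)`. -/
def IsBddFun {G : Type*} (f : G → ℝ) : Prop := ∃ C : ℝ, ∀ g, |f g| ≤ C

/-- A left `μ`-harmonic mean on `ℓ∞(G)`: a positive, normalized linear functional `Λ`
(presented on bounded representatives) with `∑_g μ(g) Λ(x ↦ φ(g⁻¹ x)) = Λ(φ)`. -/
def IsLeftHarmonicMean {G : Type*} [Group G] (μ : G → ℝ) (Λ : (G → ℝ) → ℝ) : Prop :=
  (∀ φ ψ : G → ℝ, IsBddFun φ → IsBddFun ψ → Λ (fun x => φ x + ψ x) = Λ φ + Λ ψ) ∧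
  (∀ (r : ℝ) (φ : G → ℝ), IsBddFun φ → Λ (fun x => r * φ x) = r * Λ φ) ∧
  (∀ φ : G → ℝ, IsBddFun φ → (∀ x, 0 ≤ φ x) → 0 ≤ Λ φ) ∧
  (Λ (fun _ => 1) = 1) ∧
  (∀ φ : G → ℝ, IsBddFun φ →
      HasSum (fun g : G => μ g * Λ (fun x => φ (g⁻¹ * x))) (Λ φ))

open scoped Topology

section

variable {G : Type*}

lemma isBddFun_indicator (S : Set G) : IsBddFun (S.indicator fun _ => (1 : ℝ)) :=
  ⟨1, fun g => by by_cases h : g ∈ S <;> simp [h]⟩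

/-- A bounded function converges along any ultrafilter. -/
lemma IsBddFun.exists_tendsto_ultrafilter {φ : G → ℝ} (h : IsBddFun φ) {ι : Type*}
    (U : Ultrafilter ι) (x : ι → G) : ∃ a, Tendsto (fun i => φ (x i)) U (𝓝 a) := by
  obtain ⟨C, hC⟩ := h
  obtain ⟨a, -, ha⟩ := (isCompact_Icc (a := -C) (b := C)).ultrafilter_le_nhds
    (U.map fun i => φ (x i))
    (tendsto_principal.2 (Eventually.of_forall fun i => abs_le.1 (hC (x i))))
  exact ⟨a, ha⟩

variable [Group G] {μ : G → ℝ} {Λ : (G → ℝ) → ℝ}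

namespace IsLeftHarmonicMean

lemma mono (hΛ : IsLeftHarmonicMean μ Λ) {φ ψ : G → ℝ} (hφ : IsBddFun φ) (hψ : IsBddFun ψ)
    (h : ∀ x, φ x ≤ ψ x) : Λ φ ≤ Λ ψ := by
  obtain ⟨hadd, -, hpos, -, -⟩ := hΛ
  have hd : IsBddFun fun x => ψ x - φ x := by
    obtain ⟨C, hC⟩ := hφ
    obtain ⟨D, hD⟩ := hψ
    exact ⟨D + C, fun x => (abs_sub _ _).trans (add_le_add (hD x) (hC x))⟩
  have h1 := hadd φ _ hφ hd
  have h2 := hpos _ hd fun x => sub_nonneg.2 (h x)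
  simp only [add_sub_cancel] at h1
  linarith

lemma indicator_le_one (hΛ : IsLeftHarmonicMean μ Λ) (S : Set G) :
    Λ (S.indicator fun _ => (1 : ℝ)) ≤ 1 := by
  refine (hΛ.mono (isBddFun_indicator S) ⟨1, fun _ => by simp⟩ fun x => ?_).trans_eq hΛ.2.2.2.1
  by_cases h : x ∈ S <;> simp [h]

lemma indicator_union (hΛ : IsLeftHarmonicMean μ Λ) {S T : Set G} (h : Disjoint S T) :
    Λ ((S ∪ T).indicator fun _ => (1 : ℝ)) =
      Λ (S.indicator fun _ => 1) + Λ (T.indicator fun _ => 1) := by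
  rw [← hΛ.1 _ _ (isBddFun_indicator S) (isBddFun_indicator T), Set.indicator_union_of_disjoint h]

/-- The mean of the left translates of a set is a harmonic function. -/
lemma hasSum_translate (hΛ : IsLeftHarmonicMean μ Λ) (A : Set G) (t : G) :
    HasSum (fun g => μ g * Λ ({x | (g * t)⁻¹ * x ∈ A}.indicator fun _ => (1 : ℝ)))
      (Λ ({x | t⁻¹ * x ∈ A}.indicator fun _ => (1 : ℝ))) := by
  convert hΛ.2.2.2.2 _ (isBddFun_indicator {x | t⁻¹ * x ∈ A}) using 4 with g
  funext x
  simp [Set.indicator_apply, mul_assoc]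

/-- There are finitely many translates of `A` whose union meets every translate of `A` of mean
larger than `ε`. -/
lemma exists_finset_translate_inter (hΛ : IsLeftHarmonicMean μ Λ) (A : Set G) {ε : ℝ}
    (hε : 0 < ε) : ∃ F : Finset G, ∀ t,
      ε < Λ ({x | t⁻¹ * x ∈ A}.indicator fun _ => (1 : ℝ)) →
        ∃ f ∈ F, ∃ z, f⁻¹ * z ∈ A ∧ t⁻¹ * z ∈ A := by
  let v : Finset G → ℝ := fun F => Λ ({x | ∃ f ∈ F, f⁻¹ * x ∈ A}.indicator fun _ => (1 : ℝ))
  have hv : BddAbove (Set.range v) := ⟨1, by rintro _ ⟨F, rfl⟩; exact hΛ.indicator_le_one _⟩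
  obtain ⟨F, hF⟩ := exists_lt_of_lt_ciSup (sub_lt_self (⨆ F, v F) hε)
  refine ⟨F, fun t ht => ?_⟩
  by_contra! hdisj
  have h1 : v (insert t F) = v F + Λ ({x | t⁻¹ * x ∈ A}.indicator fun _ => (1 : ℝ)) := by
    rw [← hΛ.indicator_union]
    · refine congrArg (fun S : Set G => Λ (S.indicator fun _ => (1 : ℝ))) ?_
      ext x
      simp [or_comm]
    · rw [Set.disjoint_left]
      rintro z ⟨f, hf, hz⟩ hz'
      exact hdisj f hf z hz hz'
  have h2 := le_ciSup hv (insert t F)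
  linarith

/-- Convolving a harmonic mean on the right with a limit of point masses. -/
lemma exists_eq_one_of_thick (hΛ : IsLeftHarmonicMean μ Λ) {S : Set G}
    (hS : ∀ K : Finset G, ∃ x, ∀ k ∈ K, k * x ∈ S) :
    ∃ η, IsLeftHarmonicMean μ η ∧ η (S.indicator fun _ => (1 : ℝ)) = 1 := by
  choose x hx using hS
  let U : Ultrafilter (Finset G) := Ultrafilter.of atTop
  have hU : (U : Filter (Finset G)) ≤ atTop := Ultrafilter.of_le _
  let m : (G → ℝ) → G → ℝ := fun φ y => limUnder (U : Filter (Finset G)) fun K => φ (y * x K)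
  have hm : ∀ φ, IsBddFun φ → ∀ y, Tendsto (fun K => φ (y * x K)) U (𝓝 (m φ y)) :=
    fun φ hφ y => tendsto_nhds_limUnder (hφ.exists_tendsto_ultrafilter U fun K => y * x K)
  have hmb : ∀ φ, IsBddFun φ → IsBddFun (m φ) := by
    rintro φ ⟨C, hC⟩
    exact ⟨C, fun y => le_of_tendsto (hm φ ⟨C, hC⟩ y).abs (Eventually.of_forall fun K => hC _)⟩
  obtain ⟨hadd, hsmul, hpos, hone, hharm⟩ := hΛ
  refine ⟨fun φ => Λ (m φ), ⟨fun φ ψ hφ hψ => ?_, fun r φ hφ => ?_, fun φ hφ h0 => ?_, ?_,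
    fun φ hφ => ?_⟩, ?_⟩
  · rw [← hadd _ _ (hmb φ hφ) (hmb ψ hψ)]
    refine congrArg Λ (funext fun y => ?_)
    exact ((hm φ hφ y).add (hm ψ hψ y)).limUnder_eq
  · rw [← hsmul _ _ (hmb φ hφ)]
    refine congrArg Λ (funext fun y => ?_)
    exact ((hm φ hφ y).const_mul r).limUnder_eq
  · exact hpos _ (hmb φ hφ) fun y => ge_of_tendsto (hm φ hφ y) (Eventually.of_forall fun K => h0 _)
  · refine (congrArg Λ (funext fun y => ?_)).trans hone
    exact tendsto_const_nhds.limUnder_eq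
  · convert hharm _ (hmb φ hφ) using 4 with g
    funext y
    simp only [m, mul_assoc]
  · refine (congrArg Λ (funext fun y => ?_)).trans hone
    refine (tendsto_const_nhds.congr' ?_).limUnder_eq
    filter_upwards [hU (eventually_ge_atTop {y})] with K hK
    rw [Set.indicator_of_mem (hx K y (hK (Finset.mem_singleton_self y)))]

end IsLeftHarmonicMean

/-- A bounded harmonic function whose supremum exceeds `ε` is larger than `ε` on right translates
of arbitrary finite sets. -/
lemma exists_translate_forall_lt (hprob : IsProbMeasure μ) (hgen : SuppGenerates μ) {h : G → ℝ}
    (hb : BddAbove (Set.range h)) (hharm : ∀ t, HasSum (fun g => μ g * h (g * t)) (h t))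
    {ε : ℝ} {t₀ : G} (hε : ε < h t₀) (K : Finset G) : ∃ x, ∀ k ∈ K, ε < h (k * x) := by
  set M := ⨆ t, h t
  have hM : ∀ t, h t ≤ M := le_ciSup hb
  -- Harnack inequality
  have key : ∀ k : G, ∃ C : ℝ, 0 ≤ C ∧ ∀ x, M - h (k * x) ≤ C * (M - h x) := by
    intro k
    have hk : k ∈ Subsemigroup.closure {g | 0 < μ g} := hgen ▸ Subsemigroup.mem_top k
    induction hk using Subsemigroup.closure_induction with
    | mem g hg =>
      have hg : 0 < μ g := hg
      refine ⟨(μ g)⁻¹, inv_nonneg.2 hg.le, fun x => ?_⟩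
      have hs : HasSum (fun g => μ g * (M - h (g * x))) (M - h x) := by
        simpa [mul_sub] using (hprob.2.mul_right M).sub (hharm x)
      rw [inv_mul_eq_div, le_div_iff₀' hg]
      exact le_hasSum hs g fun j _ => mul_nonneg (hprob.1 j) (sub_nonneg.2 (hM _))
    | mul a b _ _ ha hb =>
      obtain ⟨C, hC, h1⟩ := ha
      obtain ⟨D, hD, h2⟩ := hb
      refine ⟨C * D, mul_nonneg hC hD, fun x => ?_⟩
      rw [mul_assoc, mul_assoc]
      exact (h1 _).trans (mul_le_mul_of_nonneg_left (h2 x) hC)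
  choose C hC hk using key
  have hpos : 0 < ∑ k ∈ K, C k + 1 := by
    have := Finset.sum_nonneg fun k (_ : k ∈ K) => hC k
    linarith
  have hlt : M - (M - ε) / (∑ k ∈ K, C k + 1) < M :=
    sub_lt_self _ (div_pos (sub_pos.2 (hε.trans_le (hM t₀))) hpos)
  obtain ⟨x, hx⟩ := exists_lt_of_lt_ciSup hlt
  refine ⟨x, fun k hkK => ?_⟩
  have h1 : (M - h x) * (∑ k ∈ K, C k + 1) < M - ε := (lt_div_iff₀ hpos).1 (by linarith)
  have h2 : C k * (M - h x) ≤ (∑ k ∈ K, C k + 1) * (M - h x) := by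
    refine mul_le_mul_of_nonneg_right ?_ (sub_nonneg.2 (hM x))
    linarith [Finset.single_le_sum (fun k _ => hC k) hkK]
  linarith [hk k x]

end

/-- if `A ⊆ G` has positive measure for some left `μ`-harmonic mean, then
there are a finite set `F ⊆ G` and a left `μ`-harmonic mean `η` with `η(χ_{F A A⁻¹}) = 1`. -/
theorem positive_mean_product_full_measure {G : Type*} [Group G] [Countable G]
    (μ : G → ℝ) (hprob : IsProbMeasure μ) (hgen : SuppGenerates μ)
    (A : Set G)
    (Λ : (G → ℝ) → ℝ) (hΛ : IsLeftHarmonicMean μ Λ)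
    (hA : 0 < Λ (Set.indicator A fun _ => (1 : ℝ))) :
    ∃ F : Finset G, ∃ η : (G → ℝ) → ℝ, IsLeftHarmonicMean μ η ∧
      η (Set.indicator {t : G | ∃ f ∈ F, ∃ x ∈ A, ∃ y ∈ A, t = f * x * y⁻¹}
          fun _ => (1 : ℝ)) = 1 := by
  have hε := half_pos hA
  obtain ⟨F, hF⟩ := hΛ.exists_finset_translate_inter A hε
  refine ⟨F, hΛ.exists_eq_one_of_thick fun K => ?_⟩
  obtain ⟨x, hx⟩ := exists_translate_forall_lt hprob hgen
    (h := fun t => Λ ({x | t⁻¹ * x ∈ A}.indicator fun _ => (1 : ℝ)))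
    ⟨1, by rintro _ ⟨t, rfl⟩; exact hΛ.indicator_le_one _⟩ (hΛ.hasSum_translate A) (t₀ := 1)
    (ε := Λ (A.indicator fun _ => (1 : ℝ)) / 2) (by simpa using hA) K
  refine ⟨x, fun k hk => ?_⟩
  obtain ⟨f, hf, z, hz, hz'⟩ := hF _ (hx k hk)
  exact ⟨f, hf, _, hz, _, hz', by group⟩
end

section
/- Let (G, μ) be a measured group and let u : G → ℝ be a bounded left μ-harmonic function that is not identically zero and is positively correlated, i.e. sup_{g∈G} u(g) = ‖u‖_∞. Then there exists a left μ-harmonic mean λ on G with λ(χ_{S_u}) = 1, where S_u = { g ∈ G : u(g) > 0 }. -/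
open Filter
open scoped Classical

/-- `f` is left `μ`-harmonic: `f g = ∑_s f (s g) μ (s⁻¹)`. -/
def LeftMuHarmonic {G : Type*} [Group G] (μ : G → ℝ) (f : G → ℝ) : Prop :=
  ∀ g : G, HasSum (fun s => f (s * g) * μ s⁻¹) (f g)

open scoped Topology

section BoundedFunctions

variable {G : Type*} {φ ψ : G → ℝ}

theorem IsBddFun.add (hφ : IsBddFun φ) (hψ : IsBddFun ψ) : IsBddFun fun x => φ x + ψ x := by
  obtain ⟨C, hC⟩ := hφ
  obtain ⟨D, hD⟩ := hψ
  exact ⟨C + D, fun x => (abs_add_le _ _).trans (add_le_add (hC x) (hD x))⟩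

theorem IsBddFun.const_mul (r : ℝ) (hφ : IsBddFun φ) : IsBddFun fun x => r * φ x := by
  obtain ⟨C, hC⟩ := hφ
  exact ⟨|r| * C, fun x => by
    rw [abs_mul]; exact mul_le_mul_of_nonneg_left (hC x) (abs_nonneg r)⟩

theorem isBddFun_const (c : ℝ) : IsBddFun fun _ : G => c := ⟨|c|, fun _ => le_rfl⟩

theorem IsBddFun.sum {ι : Type*} {f : ι → G → ℝ} (hf : ∀ i, IsBddFun (f i)) (s : Finset ι) :
    IsBddFun fun x => ∑ i ∈ s, f i x := by
  induction s using Finset.induction_on with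
  | empty => simpa using isBddFun_const 0
  | insert i s hi ih => simpa only [Finset.sum_insert hi] using (hf i).add ih

end BoundedFunctions

/-- A mean on `ℓ∞(G)`: a positive, normalized linear functional, presented on bounded
representatives. -/
structure IsMean {G : Type*} (Λ : (G → ℝ) → ℝ) : Prop where
  add : ∀ φ ψ : G → ℝ, IsBddFun φ → IsBddFun ψ → Λ (fun x => φ x + ψ x) = Λ φ + Λ ψ
  mul : ∀ (r : ℝ) (φ : G → ℝ), IsBddFun φ → Λ (fun x => r * φ x) = r * Λ φ
  nonneg : ∀ φ : G → ℝ, IsBddFun φ → (∀ x, 0 ≤ φ x) → 0 ≤ Λ φ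
  one : Λ (fun _ => 1) = 1

namespace IsMean

variable {G : Type*} {Λ : (G → ℝ) → ℝ} {φ ψ : G → ℝ}

theorem const (h : IsMean Λ) (c : ℝ) : Λ (fun _ => c) = c := by
  simpa [h.one] using h.mul c _ (isBddFun_const 1)

theorem mono (h : IsMean Λ) (hφ : IsBddFun φ) (hψ : IsBddFun ψ) (hle : ∀ x, φ x ≤ ψ x) :
    Λ φ ≤ Λ ψ := by
  have h1 := h.nonneg _ (hψ.add (hφ.const_mul (-1))) fun x => by linarith [hle x]
  rw [h.add _ _ hψ (hφ.const_mul (-1)), h.mul _ _ hφ] at h1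
  linarith

theorem abs_le (h : IsMean Λ) {C : ℝ} (hC : ∀ x, |φ x| ≤ C) : |Λ φ| ≤ C := by
  have hφ : IsBddFun φ := ⟨C, hC⟩
  have h1 := h.mono hφ (isBddFun_const C) fun x => (_root_.abs_le.1 (hC x)).2
  have h2 := h.mono (isBddFun_const (-C)) hφ fun x => (_root_.abs_le.1 (hC x)).1
  rw [h.const] at h1 h2
  exact _root_.abs_le.2 ⟨h2, h1⟩

theorem sum (h : IsMean Λ) {ι : Type*} {f : ι → G → ℝ} (hf : ∀ i, IsBddFun (f i))
    (s : Finset ι) : Λ (fun x => ∑ i ∈ s, f i x) = ∑ i ∈ s, Λ (f i) := by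
  induction s using Finset.induction_on with
  | empty => simpa using h.const 0
  | insert i s hi ih =>
    simp only [Finset.sum_insert hi]
    rw [h.add _ _ (hf i) (IsBddFun.sum hf s), ih]

theorem dirac (x : G) : IsMean fun φ : G → ℝ => φ x :=
  ⟨fun _ _ _ _ => rfl, fun _ _ _ => rfl, fun _ _ h => h x, rfl⟩

theorem average {Θ : ℕ → (G → ℝ) → ℝ} (h : ∀ k, IsMean (Θ k)) (n : ℕ) :
    IsMean fun φ => ((n : ℝ) + 1)⁻¹ * ∑ k ∈ Finset.range (n + 1), Θ k φ where
  add φ ψ hφ hψ := by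
    simp only [(h _).add φ ψ hφ hψ, Finset.sum_add_distrib, mul_add]
  mul r φ hφ := by
    simp only [(h _).mul r φ hφ, ← Finset.mul_sum]
    ring
  nonneg φ hφ h0 :=
    mul_nonneg (by positivity) (Finset.sum_nonneg fun k _ => (h k).nonneg φ hφ h0)
  one := by
    simp only [(h _).one, Finset.sum_const, Finset.card_range, nsmul_eq_mul, mul_one]
    push_cast
    exact inv_mul_cancel₀ (by positivity)

/-- Means have a pointwise limit along any ultrafilter, which is again a mean. -/
theorem exists_tendsto_ultrafilter {ι : Type*} (U : Ultrafilter ι) {Θ : ι → (G → ℝ) → ℝ}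
    (h : ∀ i, IsMean (Θ i)) :
    ∃ Λ : (G → ℝ) → ℝ, IsMean Λ ∧
      ∀ φ, IsBddFun φ → Tendsto (fun i => Θ i φ) U (𝓝 (Λ φ)) := by
  have hlim : ∀ φ : G → ℝ, ∃ l : ℝ, IsBddFun φ → Tendsto (fun i => Θ i φ) U (𝓝 l) := by
    intro φ
    by_cases hφ : IsBddFun φ
    · obtain ⟨C, hC⟩ := hφ
      have hmem : ∀ i, Θ i φ ∈ Set.Icc (-C) C := fun i => _root_.abs_le.1 ((h i).abs_le hC)
      obtain ⟨l, -, hl⟩ := (isCompact_Icc (a := -C) (b := C)).ultrafilter_le_nhds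
        (U.map fun i => Θ i φ) (le_principal_iff.2 (mem_map.2 (univ_mem' hmem)))
      exact ⟨l, fun _ => hl⟩
    · exact ⟨0, fun h => absurd h hφ⟩
  choose Λ hΛ using hlim
  refine ⟨Λ, ⟨fun φ ψ hφ hψ => ?_, fun r φ hφ => ?_, fun φ hφ h0 => ?_, ?_⟩, hΛ⟩
  · refine tendsto_nhds_unique (hΛ _ (hφ.add hψ)) (((hΛ _ hφ).add (hΛ _ hψ)).congr fun i => ?_)
    exact ((h i).add φ ψ hφ hψ).symm
  · refine tendsto_nhds_unique (hΛ _ (hφ.const_mul r)) (((hΛ _ hφ).const_mul r).congr fun i => ?_)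
    exact ((h i).mul r φ hφ).symm
  · exact ge_of_tendsto' (hΛ _ hφ) fun i => (h i).nonneg φ hφ h0
  · refine tendsto_nhds_unique (hΛ _ (isBddFun_const 1)) (tendsto_const_nhds.congr fun i => ?_)
    exact (h i).one.symm

end IsMean

/-- The Markov operator `φ ↦ ∑_g μ(g) φ(g⁻¹ ·)`. -/
noncomputable def markovOp {G : Type*} [Group G] (μ : G → ℝ) (φ : G → ℝ) (x : G) : ℝ :=
  ∑' g, μ g * φ (g⁻¹ * x)

section MarkovOperator

variable {G : Type*} [Group G] {μ φ ψ : G → ℝ} {Λ : (G → ℝ) → ℝ}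

theorem IsProbMeasure.hasSum_markovOp (hμ : IsProbMeasure μ) (hφ : IsBddFun φ) (x : G) :
    HasSum (fun g => μ g * φ (g⁻¹ * x)) (markovOp μ φ x) := by
  obtain ⟨C, hC⟩ := hφ
  refine (Summable.of_norm_bounded (hμ.2.summable.mul_right C) fun g => ?_).hasSum
  rw [Real.norm_eq_abs, abs_mul, abs_of_nonneg (hμ.1 g)]
  exact mul_le_mul_of_nonneg_left (hC _) (hμ.1 g)

theorem IsProbMeasure.abs_markovOp_sub_sum_le (hμ : IsProbMeasure μ) {C : ℝ}
    (hC : ∀ x, |φ x| ≤ C) (s : Finset G) (x : G) :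
    |markovOp μ φ x - ∑ g ∈ s, μ g * φ (g⁻¹ * x)| ≤ (1 - ∑ g ∈ s, μ g) * C := by
  have hrest : HasSum (fun g : { g // g ∉ s } => μ g * φ ((g : G)⁻¹ * x))
      (markovOp μ φ x - ∑ g ∈ s, μ g * φ (g⁻¹ * x)) :=
    (s.hasSum_compl_iff (f := fun g => μ g * φ (g⁻¹ * x))).2
      (by simpa using hμ.hasSum_markovOp ⟨C, hC⟩ x)
  have hmass : HasSum (fun g : { g // g ∉ s } => μ g) (1 - ∑ g ∈ s, μ g) :=
    s.hasSum_compl_iff.2 (by simpa using hμ.2)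
  rw [← Real.norm_eq_abs]
  refine hrest.norm_le_of_bounded (hmass.mul_right C) fun g => ?_
  rw [Real.norm_eq_abs, abs_mul, abs_of_nonneg (hμ.1 g)]
  exact mul_le_mul_of_nonneg_left (hC _) (hμ.1 g)

theorem IsProbMeasure.isBddFun_markovOp (hμ : IsProbMeasure μ) (hφ : IsBddFun φ) :
    IsBddFun (markovOp μ φ) := by
  obtain ⟨C, hC⟩ := hφ
  exact ⟨C, fun x => by simpa using hμ.abs_markovOp_sub_sum_le hC ∅ x⟩

theorem IsMean.comp_markovOp (h : IsMean Λ) (hμ : IsProbMeasure μ) :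
    IsMean fun φ => Λ (markovOp μ φ) where
  add φ ψ hφ hψ := by
    rw [← h.add _ _ (hμ.isBddFun_markovOp hφ) (hμ.isBddFun_markovOp hψ)]
    congr 1
    funext x
    refine (hμ.hasSum_markovOp (hφ.add hψ) x).unique ?_
    simpa only [mul_add] using (hμ.hasSum_markovOp hφ x).add (hμ.hasSum_markovOp hψ x)
  mul r φ hφ := by
    rw [← h.mul _ _ (hμ.isBddFun_markovOp hφ)]
    congr 1
    funext x
    refine (hμ.hasSum_markovOp (hφ.const_mul r) x).unique ?_
    simpa only [mul_left_comm] using (hμ.hasSum_markovOp hφ x).mul_left r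
  nonneg φ hφ h0 :=
    h.nonneg _ (hμ.isBddFun_markovOp hφ) fun x => tsum_nonneg fun g => mul_nonneg (hμ.1 g) (h0 _)
  one := by
    have hone : markovOp μ (fun _ => 1) = fun _ => 1 := by
      funext x
      simpa [markovOp] using hμ.2.tsum_eq
    rw [hone, h.one]

theorem IsMean.iterate_markovOp (h : IsMean Λ) (hμ : IsProbMeasure μ) (k : ℕ) :
    IsMean fun φ => Λ ((markovOp μ)^[k] φ) := by
  induction k with
  | zero => exact h
  | succ k ih => exact ih.comp_markovOp hμ

theorem LeftMuHarmonic.markovOp_eq (hφ : LeftMuHarmonic μ φ) : markovOp μ φ = φ := by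
  funext x
  refine HasSum.tsum_eq ?_
  rw [← (Equiv.inv G).hasSum_iff]
  simpa [Function.comp_def, mul_comm] using hφ x

/-- A mean invariant under the Markov operator is harmonic. -/
theorem IsMean.isLeftHarmonicMean (h : IsMean Λ) (hμ : IsProbMeasure μ)
    (hinv : ∀ φ, IsBddFun φ → Λ (markovOp μ φ) = Λ φ) : IsLeftHarmonicMean μ Λ := by
  refine ⟨h.add, h.mul, h.nonneg, h.one, fun φ hφ => ?_⟩
  obtain ⟨C, hC⟩ := id hφ
  have htr : ∀ g : G, IsBddFun fun x => φ (g⁻¹ * x) := fun g => ⟨C, fun x => hC _⟩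
  have hbound : ∀ s : Finset G,
      |∑ g ∈ s, μ g * Λ (fun x => φ (g⁻¹ * x)) - Λ φ| ≤ (1 - ∑ g ∈ s, μ g) * C := by
    intro s
    have hs := IsBddFun.sum (fun g => (htr g).const_mul (μ g)) s
    have h1 : Λ (fun x => markovOp μ φ x + -1 * ∑ g ∈ s, μ g * φ (g⁻¹ * x)) =
        Λ φ - ∑ g ∈ s, μ g * Λ (fun x => φ (g⁻¹ * x)) := by
      rw [h.add _ _ (hμ.isBddFun_markovOp hφ) (hs.const_mul (-1)), h.mul _ _ hs,
        h.sum (fun g => (htr g).const_mul (μ g)) s, hinv φ hφ]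
      simp only [h.mul _ _ (htr _)]
      ring
    rw [abs_sub_comm, ← h1]
    refine h.abs_le fun x => ?_
    simpa [sub_eq_add_neg] using hμ.abs_markovOp_sub_sum_le hC s x
  have hzero : Tendsto (fun s : Finset G => (1 - ∑ g ∈ s, μ g) * C) atTop (𝓝 0) := by
    have hsum : Tendsto (fun s : Finset G => ∑ g ∈ s, μ g) atTop (𝓝 1) := hμ.2
    simpa using (hsum.const_sub 1).mul_const C
  exact tendsto_iff_norm_sub_tendsto_zero.2
    (squeeze_zero (fun _ => norm_nonneg _) hbound hzero)

/-- Along any sequence of base points, the Cesàro averages of the iterated Markov operator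
accumulate at a harmonic mean. -/
theorem IsProbMeasure.exists_isLeftHarmonicMean_tendsto (hμ : IsProbMeasure μ) (x : ℕ → G) :
    ∃ Λ : (G → ℝ) → ℝ, IsMean Λ ∧ IsLeftHarmonicMean μ Λ ∧
      ∀ φ, IsBddFun φ → Tendsto (fun n : ℕ => ((n : ℝ) + 1)⁻¹ *
        ∑ k ∈ Finset.range (n + 1), (markovOp μ)^[k] φ (x n)) (hyperfilter ℕ) (𝓝 (Λ φ)) := by
  have hiter : ∀ n k, IsMean fun φ => (markovOp μ)^[k] φ (x n) := fun n k =>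
    (IsMean.dirac (x n)).iterate_markovOp hμ k
  obtain ⟨Λ, hΛ, hlim⟩ := IsMean.exists_tendsto_ultrafilter (hyperfilter ℕ)
    fun n => IsMean.average (hiter n) n
  refine ⟨Λ, hΛ, hΛ.isLeftHarmonicMean hμ fun φ hφ => ?_, hlim⟩
  obtain ⟨C, hC⟩ := id hφ
  have hle : (hyperfilter ℕ : Filter ℕ) ≤ atTop := Nat.hyperfilter_le_atTop
  have hdiff := (hlim _ (hμ.isBddFun_markovOp hφ)).sub (hlim _ hφ)
  have hbound : Tendsto (fun n : ℕ => (1 / ((n : ℝ) + 1)) * (C + C)) atTop (𝓝 0) := by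
    simpa using tendsto_one_div_add_atTop_nhds_zero_nat.mul_const (C + C)
  refine sub_eq_zero.1 (tendsto_nhds_unique hdiff
    (squeeze_zero_norm (fun n => ?_) (hbound.mono_left hle)))
  rw [← mul_sub, ← Finset.sum_sub_distrib]
  simp only [← Function.iterate_succ_apply]
  rw [Finset.sum_range_sub (fun k => (markovOp μ)^[k] φ (x n)), Real.norm_eq_abs, abs_mul,
    abs_of_nonneg (by positivity), one_div]
  exact mul_le_mul_of_nonneg_left ((abs_sub _ _).trans
    (add_le_add ((hiter n _).abs_le hC) ((hiter n 0).abs_le hC))) (by positivity)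

end MarkovOperator

/-- if `u` is a bounded left `μ`-harmonic function, not identically zero and
positively correlated (`sup_g u(g) = ‖u‖_∞`), then some left `μ`-harmonic mean gives full
measure to `S_u = {g : u(g) > 0}`. -/
theorem positively_correlated_support_full_measure {G : Type*} [Group G] [Countable G]
    (μ : G → ℝ) (hprob : IsProbMeasure μ) (hgen : SuppGenerates μ)
    (u : G → ℝ) (hbdd : IsBddFun u) (hharm : LeftMuHarmonic μ u)
    (hnz : ∃ g : G, u g ≠ 0)
    -- `u` is positively correlated: `sup_g u(g) = ‖u‖_∞`
    (hpc : (⨆ g : G, u g) = ⨆ g : G, |u g|) :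
    ∃ Λ : (G → ℝ) → ℝ, IsLeftHarmonicMean μ Λ ∧
      Λ (Set.indicator {g : G | 0 < u g} fun _ => (1 : ℝ)) = 1 := by
  obtain ⟨C, hC⟩ := id hbdd
  obtain ⟨g₀, hg₀⟩ := hnz
  have hbu : BddAbove (Set.range u) :=
    ⟨C, by rintro _ ⟨g, rfl⟩; exact (le_abs_self _).trans (hC g)⟩
  have hba : BddAbove (Set.range fun g => |u g|) := ⟨C, by rintro _ ⟨g, rfl⟩; exact hC g⟩
  set M := ⨆ g, u g
  have hMpos : 0 < M := by
    rw [hpc]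
    exact (abs_pos.2 hg₀).trans_le (le_ciSup hba g₀)
  have hseq : ∀ n : ℕ, ∃ g, M - 1 / ((n : ℝ) + 1) < u g := fun n =>
    exists_lt_of_lt_ciSup (sub_lt_self _ (by positivity))
  choose x hx using hseq
  have hux : Tendsto (fun n => u (x n)) atTop (𝓝 M) :=
    tendsto_of_tendsto_of_tendsto_of_le_of_le
      (by simpa using tendsto_one_div_add_atTop_nhds_zero_nat.const_sub M) tendsto_const_nhds
      (fun n => (hx n).le) (fun n => le_ciSup hbu (x n))
  obtain ⟨Λ, hΛ, hharmΛ, hlim⟩ := hprob.exists_isLeftHarmonicMean_tendsto x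
  refine ⟨Λ, hharmΛ, ?_⟩
  have hΛu : Λ u = M := by
    refine tendsto_nhds_unique (hlim u hbdd)
      ((hux.mono_left Nat.hyperfilter_le_atTop).congr fun n => ?_)
    have hfix : ∀ k, (markovOp μ)^[k] u = u := Function.iterate_fixed hharm.markovOp_eq
    simp only [hfix, Finset.sum_const, Finset.card_range, nsmul_eq_mul]
    push_cast
    exact (inv_mul_cancel_left₀ (by positivity) _).symm
  have hind : IsBddFun (Set.indicator {g : G | 0 < u g} fun _ => (1 : ℝ)) :=
    ⟨1, fun g => by by_cases hg : 0 < u g <;> simp [hg]⟩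
  have hupper := hΛ.mono hind (isBddFun_const 1) fun g => by by_cases hg : 0 < u g <;> simp [hg]
  have hlower := hΛ.mono hbdd (hind.const_mul M) fun g => by
    by_cases hg : 0 < u g
    · simpa [hg] using le_ciSup hbu g
    · simpa [hg] using not_lt.1 hg
  rw [hΛ.one] at hupper
  rw [hΛ.mul _ _ hind, hΛu] at hlower
  exact hupper.antisymm (le_of_mul_le_mul_left (by simpa using hlower) hMpos)
end
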